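/- arXiv:1312.6155 — 2 statements merged into one kernel-verified Lean document; each statement's English description precedes it below -/
import Mathlib

section
/- Let P̲ and P̄ be real n×r matrices such that P̲_{i,j} < P̄_{i,j} for every i ∈ {1,…,n} and j ∈ {1,…,r}, and let b ∈ ℝⁿ. Consider the linear program: minimize ρ over (x¹, x², ρ) subject to P̄x¹ − P̲x² − b ≤ ρ·(1,…,1)ᵀ, x¹ ≥ 0, x² ≥ 0 (inequalities componentwise). Then every optimal solution (x¹, x², ρ) of this linear program satisfies: for every j ∈ {1,…,r}, x¹_j = 0 or x²_j = 0. -/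
/-- A positive function on a finite type is bounded below by a positive constant. -/
theorem exists_pos_le_of_finite {ι : Type*} [Finite ι] (f : ι → ℝ) (hf : ∀ i, 0 < f i) :
    ∃ δ, 0 < δ ∧ ∀ i, δ ≤ f i := by
  cases isEmpty_or_nonempty ι with
  | inl h => exact ⟨1, one_pos, fun i => h.elim i⟩
  | inr h =>
    obtain ⟨i₀, hi₀⟩ := Finite.exists_min f
    exact ⟨f i₀, hf i₀, hi₀⟩

/-- Subtracting `t` from coordinate `j` of a nonnegative vector keeps it nonnegative when
`t` is at most that coordinate. -/
theorem sub_single_nonneg {ι : Type*} [DecidableEq ι] {x : ι → ℝ} (hx : ∀ k, 0 ≤ x k)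
    {j : ι} {t : ℝ} (ht : t ≤ x j) (k : ι) : 0 ≤ (x - Pi.single j t : ι → ℝ) k := by
  rcases eq_or_ne k j with rfl | hk
  · simpa using ht
  · simpa [hk] using hx k

/-- Every optimal solution of the LP `min ρ s.t. P̄x¹ − P̲x² − b ≤ ρ·1, x¹ ≥ 0, x² ≥ 0`
(with `P̲ < P̄` entrywise) has, for every `j`, `x¹_j = 0` or `x²_j = 0`. -/
theorem stmt_0 {n r : ℕ} (Plo Pbar : Matrix (Fin n) (Fin r) ℝ) (b : Fin n → ℝ)
    (hlt : ∀ i j, Plo i j < Pbar i j)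
    (x1 x2 : Fin r → ℝ) (ρ : ℝ)
    (hfeas : (∀ i, Pbar.mulVec x1 i - Plo.mulVec x2 i - b i ≤ ρ) ∧
             (∀ j, 0 ≤ x1 j) ∧ (∀ j, 0 ≤ x2 j))
    (hopt : ∀ (y1 y2 : Fin r → ℝ) (σ : ℝ),
        ((∀ i, Pbar.mulVec y1 i - Plo.mulVec y2 i - b i ≤ σ) ∧
         (∀ j, 0 ≤ y1 j) ∧ (∀ j, 0 ≤ y2 j)) → ρ ≤ σ) :
    ∀ j, x1 j = 0 ∨ x2 j = 0 := by
  obtain ⟨hrow, h1, h2⟩ := hfeas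
  intro j
  by_contra! hne
  have ht : 0 < min (x1 j) (x2 j) :=
    lt_min ((h1 j).lt_of_ne' hne.1) ((h2 j).lt_of_ne' hne.2)
  set t := min (x1 j) (x2 j)
  obtain ⟨δ, hδ, hle⟩ := exists_pos_le_of_finite (fun i => (Pbar i j - Plo i j) * t)
    fun i => mul_pos (sub_pos.2 (hlt i j)) ht
  have key := hopt (x1 - Pi.single j t) (x2 - Pi.single j t) (ρ - δ)
    ⟨fun i => ?_, sub_single_nonneg h1 (min_le_left _ _),
      sub_single_nonneg h2 (min_le_right _ _)⟩
  · linarith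
  · have hi := hrow i
    have hδi := hle i
    simp only [Matrix.mulVec_sub, Pi.sub_apply, Matrix.mulVec_single, Pi.smul_apply,
      Matrix.col_apply, MulOpposite.smul_eq_mul_unop, MulOpposite.unop_op]
    linarith
end

section
/- Let P̲ and P̄ be real n×r matrices with P̲ ≤ P̄ entrywise, and let q ∈ ℝⁿ. Then there exists x ∈ ℝʳ such that Px ≤ q for every real n×r matrix P with P̲ ≤ P ≤ P̄ entrywise, if and only if there exist x¹, x² ∈ ℝʳ with x¹ ≥ 0, x² ≥ 0 and P̄x¹ − P̲x² ≤ q. -/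
/-- The interval linear system `[P̲, P̄]x ≤ q` has a (strong) solution iff there are
`x¹, x² ≥ 0` with `P̄x¹ − P̲x² ≤ q` (Rohn/Kreslová). -/
theorem stmt_4 {n r : ℕ} (Plo Pbar : Matrix (Fin n) (Fin r) ℝ)
    (hle : ∀ i j, Plo i j ≤ Pbar i j) (q : Fin n → ℝ) :
    (∃ x : Fin r → ℝ, ∀ P : Matrix (Fin n) (Fin r) ℝ,
        (∀ i j, Plo i j ≤ P i j ∧ P i j ≤ Pbar i j) → ∀ i, P.mulVec x i ≤ q i) ↔
    (∃ x1 x2 : Fin r → ℝ, (∀ j, 0 ≤ x1 j) ∧ (∀ j, 0 ≤ x2 j) ∧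
        ∀ i, Pbar.mulVec x1 i - Plo.mulVec x2 i ≤ q i) := by
  constructor
  · rintro ⟨x, hx⟩
    refine ⟨fun j => max (x j) 0, fun j => max (-x j) 0, fun j => le_max_right _ _,
      fun j => le_max_right _ _, fun i => ?_⟩
    have h := hx (Matrix.of fun i j => if 0 ≤ x j then Pbar i j else Plo i j) (fun i j => by
      have := hle i j
      rw [Matrix.of_apply]
      split_ifs <;> constructor <;> linarith) i
    refine le_trans (le_of_eq ?_) h
    simp only [Matrix.mulVec, dotProduct, Matrix.of_apply]
    rw [← Finset.sum_sub_distrib]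
    refine Finset.sum_congr rfl fun j _ => ?_
    split_ifs with hj
    · rw [max_eq_left hj, max_eq_right (by linarith)]
      ring
    · rw [max_eq_right (by linarith), max_eq_left (by linarith)]
      ring
  · rintro ⟨x1, x2, h1, h2, h⟩
    refine ⟨fun j => x1 j - x2 j, fun P hP i => le_trans ?_ (h i)⟩
    simp only [Matrix.mulVec, dotProduct]
    rw [← Finset.sum_sub_distrib]
    refine Finset.sum_le_sum fun j _ => ?_
    have hbar := mul_le_mul_of_nonneg_right (hP i j).2 (h1 j)
    have hlo := mul_le_mul_of_nonneg_right (hP i j).1 (h2 j)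
    linarith [mul_sub (P i j) (x1 j) (x2 j)]
end
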